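/- Assume each kernel k^j is measurable, bounded and positive semidefinite, and that the product kernel k is characteristic. Let μ be a probability measure on 𝒳 that is not equal to the product of its d marginals, and let D be an i.i.d. sample of size n from μ. Fix α ∈ (0,1) and an integer B with B ≥ 1/α − 1. Let ψ_2, …, ψ_{B+1} be i.i.d. permutation vectors, each consisting of d−1 independent permutations drawn uniformly from S_n, independent of D, and define p̂ = (1 + #{i ∈ {2,…,B+1} : dHSIĈ(ψ_i D) ≥ dHSIĈ(D)})/(B+1). Then lim_{n→∞} P(p̂ ≤ α) = 1, i.e. the permutation test using a finite sample of B permutation vectors is consistent. -/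

import Mathlib

open MeasureTheory ProbabilityTheory Filter
open scoped ENNReal Classical

instance (n : ℕ) : MeasurableSpace (Equiv.Perm (Fin n)) := ⊤

/-- The uniform distribution on the symmetric group `S_n`. -/
noncomputable def uniformPerm (n : ℕ) : Measure (Equiv.Perm (Fin n)) :=
  (PMF.uniformOfFintype (Equiv.Perm (Fin n))).toMeasure

/-- The action of a permutation vector `ψ = (ψ^1, …, ψ^{d-1})` on a dataset:
the first coordinate is kept fixed and coordinate `j+1` is permuted by `ψ^j`. -/
def permAct {d n : ℕ} {𝒳 : Fin d → Type*} (ψ : Fin (d-1) → Equiv.Perm (Fin n))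
    (D : Fin n → ∀ j, 𝒳 j) : Fin n → ∀ j, 𝒳 j :=
  fun i j => if h : j.val = 0 then D i j
    else D ((ψ ⟨j.val - 1, by have := j.isLt; omega⟩) i) j

/-- The empirical dHSIC statistic of a dataset `(x_1, …, x_n)`, built from kernels
`k^1, …, k^d`. -/
noncomputable def dHSIC {d n : ℕ} {𝒳 : Fin d → Type*} (k : ∀ j, 𝒳 j → 𝒳 j → ℝ)
    (x : Fin n → ∀ j, 𝒳 j) : ℝ :=
  (1/(n:ℝ)^2) * ∑ i : Fin n × Fin n, ∏ j, k j (x i.1 j) (x i.2 j)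
  + (1/(n:ℝ)^(2*d)) * ∑ i : Fin (2*d) → Fin n, ∏ j : Fin d,
      k j (x (i ⟨2*j.val, by have := j.isLt; omega⟩) j)
          (x (i ⟨2*j.val+1, by have := j.isLt; omega⟩) j)
  - (2/(n:ℝ)^(d+1)) * ∑ i : Fin (d+1) → Fin n, ∏ j : Fin d,
      k j (x (i 0) j) (x (i j.succ) j)

/-- A kernel is positive semidefinite if it is symmetric and all its Gram matrices are
positive semidefinite. -/
def IsPSDKernel {α : Type*} (k : α → α → ℝ) : Prop :=
  (∀ x y, k x y = k y x) ∧
    ∀ (m : ℕ) (x : Fin m → α) (c : Fin m → ℝ),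
      0 ≤ ∑ a : Fin m, ∑ b : Fin m, c a * c b * k (x a) (x b)

/-- A kernel `K` on a measurable space is characteristic if the associated squared
MMD between any two distinct probability measures is strictly positive. -/
def IsCharacteristic {α : Type*} [MeasurableSpace α] (K : α → α → ℝ) : Prop :=
  ∀ P Q : Measure α, IsProbabilityMeasure P → IsProbabilityMeasure Q → P ≠ Q →
    0 < (∫ x, ∫ y, K x y ∂P ∂P) + (∫ x, ∫ y, K x y ∂Q ∂Q)
        - 2 * ∫ x, ∫ y, K x y ∂P ∂Q

theorem MeasurePreserving.integral_comp_of_measurable {α β : Type*} [MeasurableSpace α]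
    [MeasurableSpace β] {μ : Measure α} {ν : Measure β} {f : α → β} (hf : MeasurePreserving f μ ν)
    {g : β → ℝ} (hg : Measurable g) : ∫ x, g (f x) ∂μ = ∫ y, g y ∂ν := by
  rw [← hf.map_eq, integral_map hf.measurable.aemeasurable hg.aestronglyMeasurable]

theorem measurePreserving_pi_precomp {κ τ S : Type*} [Fintype κ] [Fintype τ] [MeasurableSpace S]
    (μ : Measure S) [IsProbabilityMeasure μ] {g : τ → κ} (hg : g.Injective) :
    MeasurePreserving (fun (D : κ → S) t => D (g t))
      (Measure.pi fun _ => μ) (Measure.pi fun _ => μ) := by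
  refine ⟨by fun_prop, ?_⟩
  have hind : iIndepFun (fun (i : κ) (D : κ → S) => D i) (Measure.pi fun _ => μ) :=
    iIndepFun_pi (X := fun _ x => x) fun _ => aemeasurable_id
  rw [(iIndepFun_iff_map_fun_eq_pi_map fun t => (measurable_pi_apply _).aemeasurable).1
    (hind.precomp hg)]
  congr with t : 1
  exact (measurePreserving_eval (fun _ : κ => μ) (g t)).map_eq

theorem measurePreserving_pi_precomp_coord {κ τ J : Type*} [Fintype κ] [Fintype τ]
    {𝒳 : J → Type*} [∀ j, MeasurableSpace (𝒳 j)] (μ : Measure (∀ j, 𝒳 j))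
    [IsProbabilityMeasure μ] {g : τ → κ} (hg : g.Injective) (c : τ → J) :
    MeasurePreserving (fun (D : κ → ∀ j, 𝒳 j) t => D (g t) (c t))
      (Measure.pi fun _ => μ) (Measure.pi fun t => μ.map fun x => x (c t)) := by
  have hprob : ∀ t, IsProbabilityMeasure (μ.map fun x => x (c t)) := fun t =>
    Measure.isProbabilityMeasure_map (measurable_pi_apply _).aemeasurable
  have h : MeasurePreserving (fun (D : τ → ∀ j, 𝒳 j) t => D t (c t))
      (Measure.pi fun _ => μ) (Measure.pi fun t => μ.map fun x => x (c t)) :=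
    ⟨by fun_prop, Measure.pi_map_pi (μ := fun _ : τ => μ) (f := fun t x => x (c t))
      fun t => (measurable_pi_apply _).aemeasurable⟩
  exact h.comp (measurePreserving_pi_precomp μ hg)

/-- Reading off the coordinates of an i.i.d. sample at pairwise distinct positions produces an
i.i.d. sample from the product of the marginals. -/
theorem measurePreserving_pi_marginals {κ ι J : Type*} [Fintype κ] [Fintype ι] [Fintype J]
    {𝒳 : J → Type*} [∀ j, MeasurableSpace (𝒳 j)] (μ : Measure (∀ j, 𝒳 j))
    [IsProbabilityMeasure μ] {g : (_ : ι) × J → κ} (hg : g.Injective) :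
    MeasurePreserving (fun (D : κ → ∀ j, 𝒳 j) (l : ι) j => D (g ⟨l, j⟩) j)
      (Measure.pi fun _ => μ)
      (Measure.pi fun _ => Measure.pi fun j => μ.map fun x => x j) := by
  have hprob : ∀ j, IsProbabilityMeasure (μ.map fun x => x j) := fun j =>
    Measure.isProbabilityMeasure_map (measurable_pi_apply _).aemeasurable
  have h : MeasurePreserving (MeasurableEquiv.piCurry fun (_ : ι) j => 𝒳 j)
      (Measure.pi fun p : (_ : ι) × J => μ.map fun x => x p.2)
      (Measure.pi fun _ => Measure.pi fun j => μ.map fun x => x j) := by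
    refine ⟨MeasurableEquiv.measurable _, ?_⟩
    have := Measure.infinitePi_map_piCurry (fun (_ : ι) j => μ.map fun x : ∀ j, 𝒳 j => x j)
    simpa only [Measure.infinitePi_eq_pi] using this
  exact h.comp (measurePreserving_pi_precomp_coord μ hg fun p => p.2)

/-- The V-statistic with kernel `h`, whose arguments are indexed by `ι`. -/
noncomputable def vStat {ι S : Type*} [Fintype ι] {n : ℕ} (h : (ι → S) → ℝ) (x : Fin n → S) : ℝ :=
  (∑ i : ι → Fin n, h (x ∘ i)) / (n : ℝ) ^ Fintype.card ι

theorem abs_vStat_le {ι S : Type*} [Fintype ι] {n : ℕ} {h : (ι → S) → ℝ} {C : ℝ} (hC0 : 0 ≤ C)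
    (hC : ∀ y, |h y| ≤ C) (x : Fin n → S) : |vStat h x| ≤ C := by
  rw [vStat, abs_div, abs_of_nonneg (by positivity : (0 : ℝ) ≤ (n : ℝ) ^ Fintype.card ι)]
  refine div_le_of_le_mul₀ (by positivity) hC0 ?_
  refine (Finset.abs_sum_le_sum_abs _ _).trans ?_
  refine (Finset.sum_le_card_nsmul _ _ C fun i _ => hC _).trans_eq ?_
  simp [mul_comm]

theorem measurable_vStat {ι S : Type*} [Fintype ι] [MeasurableSpace S] {n : ℕ}
    {h : (ι → S) → ℝ} (hm : Measurable h) : Measurable (vStat h : (Fin n → S) → ℝ) := by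
  unfold vStat
  have hsum : Measurable fun x : Fin n → S => ∑ i : ι → Fin n, h (x ∘ i) :=
    Finset.measurable_sum _ fun i _ =>
      hm.comp (measurable_pi_lambda _ fun l => measurable_pi_apply _)
  exact hsum.div_const _

theorem vStat_sq {ι S : Type*} [Fintype ι] {n : ℕ} (h : (ι → S) → ℝ) (x : Fin n → S) :
    vStat h x ^ 2 = vStat (fun y : ι ⊕ ι → S => h (y ∘ Sum.inl) * h (y ∘ Sum.inr)) x := by
  rw [vStat, vStat, div_pow, sq, Finset.sum_mul_sum,
    ← Fintype.sum_prod_type' (f := fun i i' => h (x ∘ i) * h (x ∘ i')),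
    Fintype.card_sum, pow_add, ← sq]
  congr 1
  convert (Fintype.sum_equiv (Equiv.sumArrowEquivProdArrow ι ι (Fin n))
    (fun i => h ((x ∘ i) ∘ Sum.inl) * h ((x ∘ i) ∘ Sum.inr)) (fun p => h (x ∘ p.1) * h (x ∘ p.2))
    fun i => rfl).symm

/-- The random data sets `Y n` behave, as `n` grows, like i.i.d. samples from `ν`: the mean of
every bounded V-statistic converges to the mean of its kernel. -/
def AsymptoticallyIID {S : Type*} [MeasurableSpace S] {Ω : ℕ → Type*}
    [∀ n, MeasurableSpace (Ω n)] (P : ∀ n, Measure (Ω n)) (Y : ∀ n, Ω n → Fin n → S)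
    (ν : Measure S) : Prop :=
  ∀ (ι : Type) [Fintype ι] (h : (ι → S) → ℝ) (C : ℝ), Measurable h → (∀ y, |h y| ≤ C) →
    Tendsto (fun n => ∫ ω, vStat h (Y n ω) ∂P n) atTop
      (nhds (∫ y, h y ∂Measure.pi fun _ => ν))

theorem AsymptoticallyIID.tendsto_integral_sq {S : Type*} [MeasurableSpace S] {Ω : ℕ → Type*}
    [∀ n, MeasurableSpace (Ω n)] {P : ∀ n, Measure (Ω n)} [∀ n, IsProbabilityMeasure (P n)]
    {Y : ∀ n, Ω n → Fin n → S} (hYm : ∀ n, Measurable (Y n)) {ν : Measure S}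
    [IsProbabilityMeasure ν] (hY : AsymptoticallyIID P Y ν)
    {ι : Type} [Fintype ι] {h : (ι → S) → ℝ} {C : ℝ} (hm : Measurable h)
    (hC : ∀ y, |h y| ≤ C) (hC0 : 0 ≤ C) :
    Tendsto (fun n => ∫ ω, (vStat h (Y n ω) - ∫ y, h y ∂Measure.pi fun _ => ν) ^ 2 ∂P n)
      atTop (nhds 0) := by
  set θ := ∫ y, h y ∂Measure.pi fun _ => ν with hθ
  have hm2 : Measurable fun y : ι ⊕ ι → S => h (y ∘ Sum.inl) * h (y ∘ Sum.inr) :=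
    (hm.comp (measurable_pi_lambda _ fun _ => measurable_pi_apply _)).mul
      (hm.comp (measurable_pi_lambda _ fun _ => measurable_pi_apply _))
  have hC2 : ∀ y : ι ⊕ ι → S, |h (y ∘ Sum.inl) * h (y ∘ Sum.inr)| ≤ C * C := fun y => by
    rw [abs_mul]
    exact mul_le_mul (hC _) (hC _) (abs_nonneg _) hC0
  have hmean : ∫ y : ι ⊕ ι → S, h (y ∘ Sum.inl) * h (y ∘ Sum.inr) ∂Measure.pi (fun _ => ν)
      = θ * θ := by
    have := (measurePreserving_sumPiEquivProdPi (fun _ : ι ⊕ ι => ν)).integral_comp'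
      (fun p : (ι → S) × (ι → S) => h p.1 * h p.2)
    rw [integral_prod_mul] at this
    exact this
  have hlim := ((hY _ _ _ hm2 hC2).sub ((hY _ _ _ hm hC).const_mul (2 * θ))).add_const (θ ^ 2)
  rw [hmean, ← hθ] at hlim
  convert hlim using 2 with n
  · have hV : Measurable fun ω => vStat h (Y n ω) := (measurable_vStat hm).comp (hYm n)
    have hV2 := (measurable_vStat (n := n) hm2).comp (hYm n)
    have hi : Integrable (fun ω => vStat h (Y n ω)) (P n) :=
      Integrable.of_bound hV.aestronglyMeasurable C (.of_forall fun ω => abs_vStat_le hC0 hC _)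
    have hi2 : Integrable (fun ω => vStat (fun y : ι ⊕ ι → S =>
        h (y ∘ Sum.inl) * h (y ∘ Sum.inr)) (Y n ω)) (P n) :=
      Integrable.of_bound hV2.aestronglyMeasurable (C * C)
        (.of_forall fun ω => abs_vStat_le (mul_nonneg hC0 hC0) hC2 _)
    have : ∀ ω, (vStat h (Y n ω) - θ) ^ 2 = vStat (fun y : ι ⊕ ι → S =>
        h (y ∘ Sum.inl) * h (y ∘ Sum.inr)) (Y n ω) - 2 * θ * vStat h (Y n ω) + θ ^ 2 := fun ω => by
      rw [← vStat_sq]; ring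
    simp_rw [this]
    rw [integral_add (by exact hi2.sub (hi.const_mul _)) (integrable_const _),
      integral_sub hi2 (hi.const_mul _), integral_const_mul]
    simp
  · ring

theorem abs_prod_le_pow {d : ℕ} {C : ℝ} {f : Fin d → ℝ} (hf : ∀ j, |f j| ≤ C) :
    |∏ j, f j| ≤ C ^ d := by
  rw [Finset.abs_prod]
  refine (Finset.prod_le_prod (fun _ _ => abs_nonneg _) fun j _ => hf j).trans_eq ?_
  simp

theorem dHSIC_eq_vStat {d n : ℕ} {𝒳 : Fin d → Type*} (k : ∀ j, 𝒳 j → 𝒳 j → ℝ)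
    (x : Fin n → ∀ j, 𝒳 j) :
    dHSIC k x = vStat (fun y : Fin 2 → ∀ j, 𝒳 j => ∏ j, k j (y 0 j) (y 1 j)) x
      + vStat (fun y : Fin (2 * d) → ∀ j, 𝒳 j => ∏ j : Fin d,
          k j (y ⟨2 * j.val, by have := j.isLt; omega⟩ j)
            (y ⟨2 * j.val + 1, by have := j.isLt; omega⟩ j)) x
      - 2 * vStat (fun y : Fin (d + 1) → ∀ j, 𝒳 j => ∏ j : Fin d, k j (y 0 j) (y j.succ j)) x := by
  have hpair : ∑ i : Fin n × Fin n, ∏ j, k j (x i.1 j) (x i.2 j)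
      = ∑ i : Fin 2 → Fin n, ∏ j, k j (x (i 0) j) (x (i 1) j) :=
    (Fintype.sum_equiv (finTwoArrowEquiv (Fin n)) _ _ fun i => rfl).symm
  have hv : ∀ {m : ℕ} (h : (Fin m → ∀ j, 𝒳 j) → ℝ),
      vStat h x = (∑ i : Fin m → Fin n, h (x ∘ i)) / (n : ℝ) ^ m := fun h => by
    rw [vStat, Fintype.card_fin]
    congr!
  rw [dHSIC, hpair, hv, hv, hv]
  simp only [Function.comp_apply]
  ring

/-- The population dHSIC of `ν`: the squared MMD between `ν` and the product of its marginals. -/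
noncomputable def populationDHSIC {d : ℕ} {𝒳 : Fin d → Type*} [∀ j, MeasurableSpace (𝒳 j)]
    (k : ∀ j, 𝒳 j → 𝒳 j → ℝ) (ν : Measure (∀ j, 𝒳 j)) : ℝ :=
  (∫ x, ∫ y, ∏ j, k j (x j) (y j) ∂ν ∂ν)
    + (∫ x, ∫ y, ∏ j, k j (x j) (y j) ∂Measure.pi (fun j => ν.map fun z => z j)
        ∂Measure.pi (fun j => ν.map fun z => z j))
    - 2 * ∫ x, ∫ y, ∏ j, k j (x j) (y j) ∂Measure.pi (fun j => ν.map fun z => z j) ∂ν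

section Kernel

variable {d : ℕ} {𝒳 : Fin d → Type*} [∀ j, MeasurableSpace (𝒳 j)] {k : ∀ j, 𝒳 j → 𝒳 j → ℝ}

theorem measurable_prod_kernel {α : Type*} [MeasurableSpace α]
    (hk : ∀ j, Measurable fun p : 𝒳 j × 𝒳 j => k j p.1 p.2) {f g : ∀ j, α → 𝒳 j}
    (hf : ∀ j, Measurable (f j)) (hg : ∀ j, Measurable (g j)) :
    Measurable fun a => ∏ j, k j (f j a) (g j a) :=
  Finset.measurable_prod _ fun j _ => (hk j).comp ((hf j).prodMk (hg j))

theorem measurable_prod_kernel_pair (hk : ∀ j, Measurable fun p : 𝒳 j × 𝒳 j => k j p.1 p.2) :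
    Measurable fun p : (∀ j, 𝒳 j) × (∀ j, 𝒳 j) => ∏ j, k j (p.1 j) (p.2 j) :=
  measurable_prod_kernel hk (fun j => (measurable_pi_apply j).comp measurable_fst)
    fun j => (measurable_pi_apply j).comp measurable_snd

theorem measurable_dHSIC (hk : ∀ j, Measurable fun p : 𝒳 j × 𝒳 j => k j p.1 p.2) {n : ℕ} :
    Measurable (dHSIC k : (Fin n → ∀ j, 𝒳 j) → ℝ) := by
  have hev : ∀ {ι : Type} (l : ι) (j : Fin d),
      Measurable fun y : ι → ∀ j, 𝒳 j => y l j := fun l j =>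
    (measurable_pi_apply j).comp (measurable_pi_apply l)
  rw [funext (dHSIC_eq_vStat k)]
  exact ((measurable_vStat (measurable_prod_kernel hk (fun j => hev _ j) fun j => hev _ j)).add
    (measurable_vStat (measurable_prod_kernel hk (fun j => hev _ j) fun j => hev _ j))).sub
    ((measurable_vStat (measurable_prod_kernel hk (fun j => hev _ j) fun j => hev _ j)).const_mul 2)

theorem integral_prod_kernel (hk : ∀ j, Measurable fun p : 𝒳 j × 𝒳 j => k j p.1 p.2) {C : ℝ}
    (hC : ∀ j x y, |k j x y| ≤ C) (P Q : Measure (∀ j, 𝒳 j)) [IsProbabilityMeasure P]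
    [IsProbabilityMeasure Q] :
    ∫ p, ∏ j, k j (p.1 j) (p.2 j) ∂P.prod Q = ∫ x, ∫ y, ∏ j, k j (x j) (y j) ∂Q ∂P := by
  refine integral_prod _ (Integrable.of_bound ?_ (C ^ d) (.of_forall fun p => ?_))
  · exact (measurable_prod_kernel_pair hk).aestronglyMeasurable
  · exact abs_prod_le_pow fun j => hC _ _ _

theorem integral_kernel_two (hk : ∀ j, Measurable fun p : 𝒳 j × 𝒳 j => k j p.1 p.2) {C : ℝ}
    (hC : ∀ j x y, |k j x y| ≤ C) (ν : Measure (∀ j, 𝒳 j)) [IsProbabilityMeasure ν] :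
    ∫ y : Fin 2 → ∀ j, 𝒳 j, ∏ j, k j (y 0 j) (y 1 j) ∂Measure.pi (fun _ => ν)
      = ∫ x, ∫ y, ∏ j, k j (x j) (y j) ∂ν ∂ν := by
  rw [← integral_prod_kernel hk hC]
  exact (measurePreserving_finTwoArrow ν).integral_comp'
    (fun p : (∀ j, 𝒳 j) × (∀ j, 𝒳 j) => ∏ j, k j (p.1 j) (p.2 j))

theorem integral_kernel_two_mul (hk : ∀ j, Measurable fun p : 𝒳 j × 𝒳 j => k j p.1 p.2) {C : ℝ}
    (hC : ∀ j x y, |k j x y| ≤ C) (ν : Measure (∀ j, 𝒳 j)) [IsProbabilityMeasure ν] :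
    ∫ y : Fin (2 * d) → ∀ j, 𝒳 j, ∏ j : Fin d,
        k j (y ⟨2 * j.val, by have := j.isLt; omega⟩ j)
          (y ⟨2 * j.val + 1, by have := j.isLt; omega⟩ j) ∂Measure.pi (fun _ => ν)
      = ∫ x, ∫ y, ∏ j, k j (x j) (y j) ∂Measure.pi (fun j => ν.map fun z => z j)
        ∂Measure.pi (fun j => ν.map fun z => z j) := by
  have hprob : ∀ j, IsProbabilityMeasure (ν.map fun x => x j) := fun j =>
    Measure.isProbabilityMeasure_map (measurable_pi_apply _).aemeasurable
  have hinj : (Sum.elim (fun j : Fin d => (⟨2 * j.val, by have := j.isLt; omega⟩ : Fin (2 * d)))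
      fun j : Fin d => ⟨2 * j.val + 1, by have := j.isLt; omega⟩).Injective := by
    rintro (i | i) (j | j) hij <;> simp [Fin.ext_iff] at hij ⊢ <;> omega
  have hprob' : ∀ t : Fin d ⊕ Fin d,
      IsProbabilityMeasure (ν.map fun x => x (Sum.elim id id t)) := fun t => hprob _
  have hmp := (measurePreserving_sumPiEquivProdPi
    (fun t : Fin d ⊕ Fin d => ν.map fun x => x (Sum.elim id id t))).comp
    (measurePreserving_pi_precomp_coord ν hinj (Sum.elim id id))
  rw [← integral_prod_kernel hk hC]
  exact MeasurePreserving.integral_comp_of_measurable hmp (measurable_prod_kernel_pair hk)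

theorem integral_kernel_succ (hk : ∀ j, Measurable fun p : 𝒳 j × 𝒳 j => k j p.1 p.2) {C : ℝ}
    (hC : ∀ j x y, |k j x y| ≤ C) (ν : Measure (∀ j, 𝒳 j)) [IsProbabilityMeasure ν] :
    ∫ y : Fin (d + 1) → ∀ j, 𝒳 j, ∏ j : Fin d, k j (y 0 j) (y j.succ j) ∂Measure.pi (fun _ => ν)
      = ∫ x, ∫ y, ∏ j, k j (x j) (y j) ∂Measure.pi (fun j => ν.map fun z => z j) ∂ν := by
  have hprob : ∀ j, IsProbabilityMeasure (ν.map fun x => x j) := fun j =>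
    Measure.isProbabilityMeasure_map (measurable_pi_apply _).aemeasurable
  have hmp := ((MeasurePreserving.id ν).prod
    (measurePreserving_pi_precomp_coord ν (Function.injective_id (α := Fin d)) id)).comp
    (measurePreserving_piFinSuccAbove (fun _ : Fin (d + 1) => ν) 0)
  rw [← integral_prod_kernel hk hC]
  exact MeasurePreserving.integral_comp_of_measurable hmp (measurable_prod_kernel_pair hk)

theorem populationDHSIC_pi {μ : ∀ j, Measure (𝒳 j)} [∀ j, IsProbabilityMeasure (μ j)] :
    populationDHSIC k (Measure.pi μ) = 0 := by
  have hmarg : (fun j => (Measure.pi μ).map fun z => z j) = μ :=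
    funext fun j => (measurePreserving_eval μ j).map_eq
  rw [populationDHSIC, hmarg]
  ring

theorem AsymptoticallyIID.tendsto_integral_dHSIC_sub_sq {Ω : ℕ → Type*}
    [∀ n, MeasurableSpace (Ω n)] {P : ∀ n, Measure (Ω n)} [∀ n, IsProbabilityMeasure (P n)]
    {Y : ∀ n, Ω n → Fin n → ∀ j, 𝒳 j} (hYm : ∀ n, Measurable (Y n)) {ν : Measure (∀ j, 𝒳 j)}
    [IsProbabilityMeasure ν] (hY : AsymptoticallyIID P Y ν)
    (hk : ∀ j, Measurable fun p : 𝒳 j × 𝒳 j => k j p.1 p.2) {C : ℝ} (hC0 : 0 ≤ C)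
    (hC : ∀ j x y, |k j x y| ≤ C) :
    Tendsto (fun n => ∫ ω, (dHSIC k (Y n ω) - populationDHSIC k ν) ^ 2 ∂P n) atTop (nhds 0) := by
  have hev : ∀ {ι : Type} (l : ι) (j : Fin d),
      Measurable fun y : ι → ∀ j, 𝒳 j => y l j := fun l j =>
    (measurable_pi_apply j).comp (measurable_pi_apply l)
  have key : ∀ {m : ℕ} (a b : Fin d → Fin m),
      Tendsto (fun n => ∫ ω, (vStat (fun y : Fin m → ∀ j, 𝒳 j => ∏ j, k j (y (a j) j) (y (b j) j))
        (Y n ω) - ∫ y : Fin m → ∀ j, 𝒳 j, ∏ j, k j (y (a j) j) (y (b j) j)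
          ∂Measure.pi fun _ => ν) ^ 2 ∂P n) atTop (nhds 0) ∧
      ∀ (n : ℕ) (θ : ℝ), Integrable (fun ω => (vStat (fun y : Fin m → ∀ j, 𝒳 j =>
        ∏ j, k j (y (a j) j) (y (b j) j)) (Y n ω) - θ) ^ 2) (P n) := fun a b => by
    have hm := measurable_prod_kernel hk (fun j => hev (a j) j) fun j => hev (b j) j
    have hb := fun y : Fin _ → ∀ j, 𝒳 j =>
      abs_prod_le_pow fun j => hC j (y (a j) j) (y (b j) j)
    refine ⟨hY.tendsto_integral_sq hYm hm hb (pow_nonneg hC0 _), fun n θ => ?_⟩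
    refine Integrable.of_bound
      ((((measurable_vStat hm).comp (hYm n)).sub_const θ).pow_const 2).aestronglyMeasurable
      ((C ^ d + |θ|) ^ 2) (.of_forall fun ω => ?_)
    rw [norm_pow]
    gcongr
    exact (norm_sub_le _ _).trans (add_le_add_left (abs_vStat_le (pow_nonneg hC0 _) hb _) _)
  obtain ⟨hA, hAi⟩ := key (fun _ => (0 : Fin 2)) fun _ => 1
  obtain ⟨hB, hBi⟩ := key (fun j => (⟨2 * j.val, by have := j.isLt; omega⟩ : Fin (2 * d)))
    fun j => ⟨2 * j.val + 1, by have := j.isLt; omega⟩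
  obtain ⟨hD, hDi⟩ := key (fun _ => (0 : Fin (d + 1))) Fin.succ
  rw [integral_kernel_two hk hC] at hA
  rw [integral_kernel_two_mul hk hC] at hB
  rw [integral_kernel_succ hk hC] at hD
  have hlim := ((hA.const_mul 3).add (hB.const_mul 3)).add (hD.const_mul 12)
  simp only [mul_zero, add_zero] at hlim
  refine squeeze_zero (fun n => integral_nonneg fun ω => sq_nonneg _) (fun n => ?_) hlim
  have hsum : ∀ {u v w : Ω n → ℝ}, Integrable u (P n) → Integrable v (P n) → Integrable w (P n) →
      3 * (∫ ω, u ω ∂P n) + 3 * (∫ ω, v ω ∂P n) + 12 * (∫ ω, w ω ∂P n)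
        = ∫ ω, (3 * u ω + 3 * v ω + 12 * w ω) ∂P n := fun hu hv hw => by
    rw [integral_add (by exact (hu.const_mul 3).add (hv.const_mul 3)) (hw.const_mul 12),
      integral_add (hu.const_mul 3) (hv.const_mul 3), integral_const_mul, integral_const_mul,
      integral_const_mul]
  rw [hsum (hAi n _) (hBi n _) (hDi n _)]
  refine integral_mono_of_nonneg (.of_forall fun ω => sq_nonneg _)
    ((((hAi n _).const_mul 3).add ((hBi n _).const_mul 3)).add ((hDi n _).const_mul 12))
    (.of_forall fun ω => ?_)
  have hpoly : ∀ u v w a b c : ℝ, (u + v - 2 * w - (a + b - 2 * c)) ^ 2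
      ≤ 3 * (u - a) ^ 2 + 3 * (v - b) ^ 2 + 12 * (w - c) ^ 2 := fun u v w a b c => by
    nlinarith [sq_nonneg ((u - a) - (v - b)), sq_nonneg ((u - a) + 2 * (w - c)),
      sq_nonneg ((v - b) + 2 * (w - c))]
  simp only [dHSIC_eq_vStat, populationDHSIC]
  exact hpoly _ _ _ _ _ _

end Kernel

/-- If a bounded function on a finite set equals `θ` wherever the points `g z` are pairwise
distinct, and collisions between any two of them are rare, then its average is close to `θ`. -/
theorem abs_average_sub_le_of_collisions {Z T : Type*} [Fintype Z] [Nonempty Z] [Fintype T] {n : ℕ}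
    (hn : 0 < n) {F : Z → ℝ} {θ C : ℝ} (hF : ∀ z, |F z| ≤ C) (hθ : |θ| ≤ C) {g : Z → T → Fin n}
    (hgood : ∀ z, (g z).Injective → F z = θ)
    (hg : ∀ p q, p ≠ q → (Finset.univ.filter fun z => g z p = g z q).card * n ≤ Fintype.card Z) :
    |(∑ z, F z) / Fintype.card Z - θ| ≤ 2 * C * (Fintype.card T) ^ 2 / n := by
  have hC0 : 0 ≤ C := (abs_nonneg θ).trans hθ
  have hZ : (0 : ℝ) < Fintype.card Z := by exact_mod_cast Fintype.card_pos
  have hn' : (0 : ℝ) < n := by exact_mod_cast hn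
  have hterm : ∀ z, |F z - θ| ≤ ∑ p : T × T,
      if p.1 ≠ p.2 ∧ g z p.1 = g z p.2 then 2 * C else 0 := fun z => by
    have hnn : ∀ p : T × T, 0 ≤ if p.1 ≠ p.2 ∧ g z p.1 = g z p.2 then 2 * C else 0 := fun p => by
      split_ifs <;> positivity
    by_cases hz : (g z).Injective
    · rw [hgood z hz, sub_self, abs_zero]
      exact Finset.sum_nonneg fun p _ => hnn p
    · obtain ⟨p, q, hpq, hne⟩ := Function.not_injective_iff.1 hz
      refine le_trans ?_ (Finset.single_le_sum (fun p _ => hnn p) (Finset.mem_univ (p, q)))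
      rw [if_pos ⟨hne, hpq⟩]
      exact (abs_sub _ _).trans (by linarith [hF z])
  have hpair : ∀ p : T × T, (∑ z, if p.1 ≠ p.2 ∧ g z p.1 = g z p.2 then 2 * C else 0)
      ≤ 2 * C * (Fintype.card Z / n) := fun p => by
    by_cases hp : p.1 = p.2
    · simp only [hp, ne_eq, not_true_eq_false, false_and, if_false, Finset.sum_const_zero]
      positivity
    · simp only [ne_eq, hp, not_false_eq_true, true_and]
      rw [← Finset.sum_filter, Finset.sum_const, nsmul_eq_mul, mul_comm]
      refine mul_le_mul_of_nonneg_left ?_ (by positivity)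
      rw [le_div_iff₀ hn']
      exact_mod_cast hg _ _ hp
  have hsub : (∑ z, F z) / Fintype.card Z - θ = (∑ z, (F z - θ)) / Fintype.card Z := by
    rw [Finset.sum_sub_distrib, Finset.sum_const, Finset.card_univ, nsmul_eq_mul]
    field_simp
  rw [hsub, abs_div, abs_of_pos hZ, div_le_iff₀ hZ]
  calc |∑ z, (F z - θ)| ≤ ∑ z, |F z - θ| := Finset.abs_sum_le_sum_abs _ _
    _ ≤ ∑ z, ∑ p : T × T, if p.1 ≠ p.2 ∧ g z p.1 = g z p.2 then 2 * C else 0 :=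
      Finset.sum_le_sum fun z _ => hterm z
    _ = ∑ p : T × T, ∑ z, if p.1 ≠ p.2 ∧ g z p.1 = g z p.2 then 2 * C else 0 := Finset.sum_comm
    _ ≤ ∑ _p : T × T, 2 * C * (Fintype.card Z / n) := Finset.sum_le_sum fun p _ => hpair p
    _ = 2 * C * (Fintype.card T) ^ 2 / n * Fintype.card Z := by
      rw [Finset.sum_const, Finset.card_univ, Fintype.card_prod, nsmul_eq_mul]
      push_cast
      ring

/-- Counting by resampling: if each point of `s` can be modified by a parameter in `Fin n`
so that the point and the parameter are recovered from the result, then `s` is small. -/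
theorem card_mul_le_of_injOn {Z : Type*} [Fintype Z] {n : ℕ} (s : Finset Z) (f : Z × Fin n → Z)
    (hf : Set.InjOn f (s ×ˢ Finset.univ : Finset (Z × Fin n))) : s.card * n ≤ Fintype.card Z := by
  have := Finset.card_le_card_of_injOn f (fun _ _ => Finset.mem_univ _) hf
  simpa using this

theorem card_filter_eq_mul_le {W ι : Type*} [Fintype W] [Fintype ι] {n : ℕ}
    (σ τ : W → Equiv.Perm (Fin n)) {l l' : ι} (hl : l ≠ l') :
    (Finset.univ.filter fun z : W × (ι → Fin n) => σ z.1 (z.2 l) = τ z.1 (z.2 l')).card * n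
      ≤ Fintype.card (W × (ι → Fin n)) := by
  refine card_mul_le_of_injOn _ (fun p => (p.1.1, Function.update p.1.2 l p.2)) ?_
  rintro ⟨⟨w, i⟩, a⟩ h ⟨⟨w', i'⟩, a'⟩ h' heq
  simp only [Finset.coe_product, Set.mem_prod, Finset.mem_coe, Finset.mem_filter, Finset.mem_univ,
    true_and, and_true, Finset.coe_univ, Set.mem_univ] at h h'
  simp only [Prod.mk.injEq] at heq ⊢
  obtain ⟨rfl, hu⟩ := heq
  have ha : a = a' := by simpa using congrFun hu l
  have hoff : ∀ m, m ≠ l → i m = i' m := fun m hm => by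
    simpa [Function.update_of_ne hm] using congrFun hu m
  refine ⟨⟨rfl, funext fun m => ?_⟩, ha⟩
  by_cases hm : m = l
  · subst hm
    apply (σ w).injective
    rw [h, h', hoff _ hl.symm]
  · exact hoff m hm

theorem card_filter_perm_apply_eq_mul_le {A V : Type*} [Fintype A] [DecidableEq A] [Fintype V]
    {n : ℕ} (a : A)
    (v : V → Fin n) (c : (A → Equiv.Perm (Fin n)) → V → Fin n)
    (hc : ∀ ψ σ i, c (Function.update ψ a σ) i = c ψ i) :
    (Finset.univ.filter fun z : (A → Equiv.Perm (Fin n)) × V => z.1 a (v z.2) = c z.1 z.2).card * n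
      ≤ Fintype.card ((A → Equiv.Perm (Fin n)) × V) := by
  refine card_mul_le_of_injOn _ (fun p =>
    (Function.update p.1.1 a (Equiv.swap (c p.1.1 p.1.2) p.2 * p.1.1 a), p.1.2)) ?_
  rintro ⟨⟨ψ, i⟩, b⟩ h ⟨⟨ψ', i'⟩, b'⟩ h' heq
  simp only [Finset.coe_product, Set.mem_prod, Finset.mem_coe, Finset.mem_filter, Finset.mem_univ,
    true_and, and_true, Finset.coe_univ, Set.mem_univ] at h h'
  simp only [Prod.mk.injEq] at heq ⊢
  obtain ⟨hu, rfl⟩ := heq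
  have hcc : c ψ i = c ψ' i := by
    rw [← hc ψ (Equiv.swap (c ψ i) b * ψ a), hu, hc]
  have hat : Equiv.swap (c ψ i) b * ψ a = Equiv.swap (c ψ' i) b' * ψ' a := by
    simpa using congrFun hu a
  have hb : b = b' := by
    have := congrArg (fun σ : Equiv.Perm (Fin n) => σ (v i)) hat
    simpa [h, h'] using this
  subst hb
  refine ⟨⟨funext fun m => ?_, rfl⟩, rfl⟩
  by_cases hm : m = a
  · subst hm
    rw [hcc] at hat
    exact mul_left_cancel hat
  · simpa [Function.update_of_ne hm] using congrFun hu m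

instance (n : ℕ) : IsProbabilityMeasure (uniformPerm n) := by
  unfold uniformPerm
  infer_instance

theorem pi_uniformPerm_real_singleton {A : Type*} [Fintype A] [DecidableEq A] {n : ℕ}
    (ψ : A → Equiv.Perm (Fin n)) :
    (Measure.pi fun _ : A => uniformPerm n).real {ψ}
      = (Fintype.card (A → Equiv.Perm (Fin n)) : ℝ)⁻¹ := by
  have h1 : ∀ σ : Equiv.Perm (Fin n),
      uniformPerm n {σ} = (Fintype.card (Equiv.Perm (Fin n)) : ℝ≥0∞)⁻¹ := fun σ => by
    rw [uniformPerm, PMF.toMeasure_apply_singleton _ _ (MeasurableSpace.measurableSet_top)]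
    simp
  rw [measureReal_def, Measure.pi_singleton]
  simp [h1, Fintype.card_pi]

instance (n : ℕ) : DiscreteMeasurableSpace (Equiv.Perm (Fin n)) :=
  ⟨fun _ => MeasurableSpace.measurableSet_top⟩

theorem integral_pi_uniformPerm {A : Type*} [Fintype A] [DecidableEq A] {n : ℕ}
    (F : (A → Equiv.Perm (Fin n)) → ℝ) :
    ∫ ψ, F ψ ∂(Measure.pi fun _ : A => uniformPerm n)
      = (∑ ψ, F ψ) / Fintype.card (A → Equiv.Perm (Fin n)) := by
  rw [integral_fintype (.of_finite)]
  simp only [pi_uniformPerm_real_singleton, smul_eq_mul]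
  rw [← Finset.mul_sum, div_eq_inv_mul]

theorem integral_vStat_eq_average {A ι S : Type*} [Fintype A] [DecidableEq A] [Fintype ι]
    [MeasurableSpace S] (μ : Measure S) [IsProbabilityMeasure μ] {n : ℕ} {h : (ι → S) → ℝ} (hm : Measurable h) {C : ℝ}
    (hC0 : 0 ≤ C) (hC : ∀ y, |h y| ≤ C)
    {Y : (A → Equiv.Perm (Fin n)) → (Fin n → S) → Fin n → S} (hY : ∀ ψ, Measurable (Y ψ)) :
    ∫ ω, vStat h (Y ω.2 ω.1) ∂(Measure.pi fun _ : Fin n => μ).prod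
        (Measure.pi fun _ : A => uniformPerm n)
      = (∑ z : (A → Equiv.Perm (Fin n)) × (ι → Fin n),
          ∫ D, h (Y z.1 D ∘ z.2) ∂Measure.pi fun _ => μ)
        / Fintype.card ((A → Equiv.Perm (Fin n)) × (ι → Fin n)) := by
  have hYm : Measurable fun ω : (Fin n → S) × (A → Equiv.Perm (Fin n)) => Y ω.2 ω.1 :=
    measurable_from_prod_countable_left hY
  have hint : Integrable (fun ω : (Fin n → S) × (A → Equiv.Perm (Fin n)) => vStat h (Y ω.2 ω.1))
      ((Measure.pi fun _ : Fin n => μ).prod (Measure.pi fun _ : A => uniformPerm n)) :=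
    Integrable.of_bound ((measurable_vStat hm).comp hYm).aestronglyMeasurable C
      (.of_forall fun ω => abs_vStat_le hC0 hC _)
  rw [integral_prod_symm _ hint, integral_pi_uniformPerm, Fintype.sum_prod_type, Fintype.card_prod]
  simp only [vStat]
  have hinner : ∀ ψ, ∫ D, (∑ i : ι → Fin n, h (Y ψ D ∘ i)) / (n : ℝ) ^ Fintype.card ι
        ∂Measure.pi (fun _ => μ)
      = (∑ i : ι → Fin n, ∫ D, h (Y ψ D ∘ i) ∂Measure.pi fun _ => μ)
        / (n : ℝ) ^ Fintype.card ι := fun ψ => by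
    rw [integral_div, integral_finsetSum]
    refine fun i _ => Integrable.of_bound (hm.comp ?_).aestronglyMeasurable C
      (.of_forall fun D => hC _)
    exact measurable_pi_lambda _ fun l => (measurable_pi_apply _).comp (hY ψ)
  simp only [hinner]
  rw [← Finset.sum_div, div_div, mul_comm]
  simp

theorem abs_integral_le_of_abs_le {α : Type*} [MeasurableSpace α] (ν : Measure α)
    [IsProbabilityMeasure ν] {h : α → ℝ} {C : ℝ} (hC : ∀ y, |h y| ≤ C) : |∫ y, h y ∂ν| ≤ C := by
  have := norm_integral_le_of_norm_le_const (μ := ν) (f := h) (C := C) (.of_forall hC)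
  simpa using this

/-- A criterion for convergence of means of V-statistics of data obtained by resampling. -/
theorem tendsto_integral_vStat_of_collisions {A ι T S : Type*} [Fintype A] [DecidableEq A]
    [Fintype ι] [Fintype T] [MeasurableSpace S] (μ : Measure S) [IsProbabilityMeasure μ] {h : (ι → S) → ℝ}
    (hm : Measurable h) {C θ : ℝ} (hC : ∀ y, |h y| ≤ C) (hθ : |θ| ≤ C)
    {Y : ∀ n, (A → Equiv.Perm (Fin n)) → (Fin n → S) → Fin n → S} (hY : ∀ n ψ, Measurable (Y n ψ))
    {g : ∀ n, (A → Equiv.Perm (Fin n)) × (ι → Fin n) → T → Fin n}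
    (hgood : ∀ n z, (g n z).Injective → ∫ D, h (Y n z.1 D ∘ z.2) ∂Measure.pi (fun _ => μ) = θ)
    (hg : ∀ n p q, p ≠ q → (Finset.univ.filter fun z => g n z p = g n z q).card * n
      ≤ Fintype.card ((A → Equiv.Perm (Fin n)) × (ι → Fin n))) :
    Tendsto (fun n => ∫ ω, vStat h (Y n ω.2 ω.1) ∂(Measure.pi fun _ : Fin n => μ).prod
        (Measure.pi fun _ : A => uniformPerm n)) atTop (nhds θ) := by
  have hC0 : 0 ≤ C := (abs_nonneg θ).trans hθ
  rw [tendsto_iff_norm_sub_tendsto_zero]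
  refine squeeze_zero' (.of_forall fun n => norm_nonneg _) ?_
    (tendsto_const_div_atTop_nhds_zero_nat (2 * C * (Fintype.card T) ^ 2))
  filter_upwards [eventually_gt_atTop 0] with n hn
  have : Nonempty (Fin n) := ⟨⟨0, hn⟩⟩
  rw [integral_vStat_eq_average μ hm hC0 hC (hY n)]
  exact abs_average_sub_le_of_collisions hn
    (fun z => abs_integral_le_of_abs_le _ fun D => hC _) hθ (hgood n) (hg n)

theorem asymptoticallyIID_sample {A S : Type*} [Fintype A] [DecidableEq A] [MeasurableSpace S]
    (μ : Measure S) [IsProbabilityMeasure μ] :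
    AsymptoticallyIID (fun n => (Measure.pi fun _ : Fin n => μ).prod
      (Measure.pi fun _ : A => uniformPerm n)) (fun _ ω => ω.1) μ := by
  intro ι _ h C hm hC
  refine tendsto_integral_vStat_of_collisions (A := A) μ hm hC (abs_integral_le_of_abs_le _ hC)
    (Y := fun _ _ D => D) (fun _ _ => measurable_id) (g := fun _ z => z.2) (fun n z hz => ?_)
    fun n p q hpq => ?_
  · exact MeasurePreserving.integral_comp_of_measurable (measurePreserving_pi_precomp μ hz) hm
  · exact card_filter_eq_mul_le (fun _ => 1) (fun _ => 1) hpq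

/-- The permutation applied by `permAct` to the `j`-th coordinate. -/
def coordPerm {d n : ℕ} (ψ : Fin (d - 1) → Equiv.Perm (Fin n)) (j : Fin d) : Equiv.Perm (Fin n) :=
  if h : j.val = 0 then 1 else ψ ⟨j.val - 1, by have := j.isLt; omega⟩

theorem permAct_apply {d n : ℕ} {𝒳 : Fin d → Type*} (ψ : Fin (d - 1) → Equiv.Perm (Fin n))
    (D : Fin n → ∀ j, 𝒳 j) (i : Fin n) (j : Fin d) :
    permAct ψ D i j = D (coordPerm ψ j i) j := by
  unfold permAct coordPerm
  split_ifs <;> rfl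

theorem measurable_permAct {d n : ℕ} {𝒳 : Fin d → Type*} [∀ j, MeasurableSpace (𝒳 j)]
    (ψ : Fin (d - 1) → Equiv.Perm (Fin n)) :
    Measurable (permAct ψ : (Fin n → ∀ j, 𝒳 j) → Fin n → ∀ j, 𝒳 j) := by
  refine measurable_pi_lambda _ fun i => measurable_pi_lambda _ fun j => ?_
  simp only [permAct_apply]
  exact (measurable_pi_apply j).comp (measurable_pi_apply _)

theorem card_filter_coordPerm_eq_mul_le {d n : ℕ} {V : Type*} [Fintype V] (v : V → Fin n)
    {j j' : Fin d} (hj : j ≠ j') :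
    (Finset.univ.filter fun z : (Fin (d - 1) → Equiv.Perm (Fin n)) × V =>
        coordPerm z.1 j (v z.2) = coordPerm z.1 j' (v z.2)).card * n
      ≤ Fintype.card ((Fin (d - 1) → Equiv.Perm (Fin n)) × V) := by
  wlog h0 : j.val ≠ 0 generalizing j j'
  · have hj' : j'.val ≠ 0 := fun h => hj (Fin.ext (by omega))
    simpa only [eq_comm] using this hj.symm hj'
  have hlt : j.val - 1 < d - 1 := by have := j.isLt; omega
  have := card_filter_perm_apply_eq_mul_le (⟨j.val - 1, hlt⟩ : Fin (d - 1)) v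
    (fun ψ i => coordPerm ψ j' (v i)) fun ψ σ i => by
      unfold coordPerm
      split_ifs with h
      · rfl
      · rw [Function.update_of_ne]
        intro he
        rw [Fin.mk.injEq] at he
        exact hj (Fin.ext (by omega))
  convert this using 6
  rw [coordPerm, dif_neg h0]

theorem asymptoticallyIID_permAct {d : ℕ} {𝒳 : Fin d → Type*} [∀ j, MeasurableSpace (𝒳 j)]
    (μ : Measure (∀ j, 𝒳 j)) [IsProbabilityMeasure μ] :
    AsymptoticallyIID (fun n => (Measure.pi fun _ : Fin n => μ).prod
      (Measure.pi fun _ : Fin (d - 1) => uniformPerm n)) (fun _ ω => permAct ω.2 ω.1)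
      (Measure.pi fun j => μ.map fun x => x j) := by
  have hprob : ∀ j, IsProbabilityMeasure (μ.map fun x => x j) := fun j =>
    Measure.isProbabilityMeasure_map (measurable_pi_apply _).aemeasurable
  intro ι _ h C hm hC
  refine tendsto_integral_vStat_of_collisions (T := (_ : ι) × Fin d) μ hm hC
    (abs_integral_le_of_abs_le _ hC) (Y := fun _ ψ D => permAct ψ D)
    (fun _ ψ => measurable_permAct ψ) (g := fun _ z p => coordPerm z.1 p.2 (z.2 p.1))
    (fun n z hz => ?_) ?_
  · rw [← MeasurePreserving.integral_comp_of_measurable (measurePreserving_pi_marginals μ hz) hm]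
    refine integral_congr_ae (.of_forall fun D => congrArg h ?_)
    exact funext fun l => funext fun j => permAct_apply _ _ _ _
  · rintro n ⟨l, j⟩ ⟨l', j'⟩ hne
    by_cases hl : l = l'
    · subst hl
      have hj : j ≠ j' := fun hj => hne (by rw [hj])
      exact card_filter_coordPerm_eq_mul_le (fun i : ι → Fin n => i l) hj
    · exact card_filter_eq_mul_le (fun ψ => coordPerm ψ j) (fun ψ => coordPerm ψ j') hl

theorem tendsto_measure_abs_ge_of_tendsto_integral_sq {Ω : ℕ → Type*}
    [∀ n, MeasurableSpace (Ω n)] {P : ∀ n, Measure (Ω n)} [∀ n, IsProbabilityMeasure (P n)]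
    {f : ∀ n, Ω n → ℝ} (hi : ∀ n, Integrable (fun ω => f n ω ^ 2) (P n))
    (hf : Tendsto (fun n => ∫ ω, f n ω ^ 2 ∂P n) atTop (nhds 0)) {ε : ℝ} (hε : 0 < ε) :
    Tendsto (fun n => P n {ω | ε ≤ |f n ω|}) atTop (nhds 0) := by
  have hlim : Tendsto (fun n => ENNReal.ofReal ((∫ ω, f n ω ^ 2 ∂P n) / ε ^ 2)) atTop (nhds 0) := by
    have := ENNReal.tendsto_ofReal (hf.div_const (ε ^ 2))
    simpa using this
  refine tendsto_of_tendsto_of_tendsto_of_le_of_le tendsto_const_nhds hlim (fun _ => zero_le)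
    fun n => ?_
  have hmarkov := mul_meas_ge_le_integral_of_nonneg (.of_forall fun ω => sq_nonneg (f n ω))
    (hi n) (ε ^ 2)
  have hsub : P n {ω | ε ≤ |f n ω|} ≤ P n {ω | ε ^ 2 ≤ f n ω ^ 2} := by
    refine measure_mono fun ω hω => ?_
    rw [Set.mem_ofPred_eq, ← sq_abs (f n ω)]
    exact pow_le_pow_left₀ hε.le hω 2
  refine hsub.trans ?_
  rw [← ENNReal.ofReal_toReal (measure_ne_top (P n) {ω | ε ^ 2 ≤ f n ω ^ 2})]
  refine ENNReal.ofReal_le_ofReal ?_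
  rw [le_div_iff₀ (by positivity), mul_comm]
  exact hmarkov

theorem abs_dHSIC_le {d n : ℕ} {𝒳 : Fin d → Type*} {k : ∀ j, 𝒳 j → 𝒳 j → ℝ} {C : ℝ}
    (hC0 : 0 ≤ C) (hC : ∀ j x y, |k j x y| ≤ C) (x : Fin n → ∀ j, 𝒳 j) :
    |dHSIC k x| ≤ 4 * C ^ d := by
  have hv : ∀ {m : ℕ} (a b : Fin d → Fin m), |vStat (fun y : Fin m → ∀ j, 𝒳 j =>
      ∏ j, k j (y (a j) j) (y (b j) j)) x| ≤ C ^ d := fun a b =>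
    abs_vStat_le (pow_nonneg hC0 _) (fun y => abs_prod_le_pow fun j => hC _ _ _) x
  have hA := abs_le.1 (hv (fun _ => (0 : Fin 2)) fun _ => 1)
  have hB := abs_le.1 (hv (fun j => (⟨2 * j.val, by have := j.isLt; omega⟩ : Fin (2 * d)))
    fun j => ⟨2 * j.val + 1, by have := j.isLt; omega⟩)
  have hD := abs_le.1 (hv (fun _ => (0 : Fin (d + 1))) Fin.succ)
  rw [dHSIC_eq_vStat, abs_le]
  constructor <;> linarith [hA.1, hA.2, hB.1, hB.2, hD.1, hD.2]

/-- Under an alternative, one random permutation vector reaches the observed value of dHSIC with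
vanishing probability. -/
theorem tendsto_measure_dHSIC_le_dHSIC_permAct {d : ℕ} {𝒳 : Fin d → Type*}
    [∀ j, MeasurableSpace (𝒳 j)] {k : ∀ j, 𝒳 j → 𝒳 j → ℝ}
    (hk : ∀ j, Measurable fun p : 𝒳 j × 𝒳 j => k j p.1 p.2) {C : ℝ} (hC0 : 0 ≤ C)
    (hC : ∀ j x y, |k j x y| ≤ C) (μ : Measure (∀ j, 𝒳 j)) [IsProbabilityMeasure μ]
    (hμ : 0 < populationDHSIC k μ) :
    Tendsto (fun n => ((Measure.pi fun _ : Fin n => μ).prod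
      (Measure.pi fun _ : Fin (d - 1) => uniformPerm n))
        {ω | dHSIC k ω.1 ≤ dHSIC k (permAct ω.2 ω.1)}) atTop (nhds 0) := by
  have hprob : ∀ j, IsProbabilityMeasure (μ.map fun x => x j) := fun j =>
    Measure.isProbabilityMeasure_map (measurable_pi_apply _).aemeasurable
  have key : ∀ {Y : ∀ n, (Fin n → ∀ j, 𝒳 j) × (Fin (d - 1) → Equiv.Perm (Fin n)) →
      Fin n → ∀ j, 𝒳 j} {ν : Measure (∀ j, 𝒳 j)} [IsProbabilityMeasure ν],
      (∀ n, Measurable (Y n)) → AsymptoticallyIID (fun n => (Measure.pi fun _ : Fin n => μ).prod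
        (Measure.pi fun _ : Fin (d - 1) => uniformPerm n)) Y ν →
      Tendsto (fun n => ((Measure.pi fun _ : Fin n => μ).prod
        (Measure.pi fun _ : Fin (d - 1) => uniformPerm n))
          {ω | populationDHSIC k μ / 2 ≤ |dHSIC k (Y n ω) - populationDHSIC k ν|})
        atTop (nhds 0) := by
    intro Y ν _ hYm hY
    refine tendsto_measure_abs_ge_of_tendsto_integral_sq
      (P := fun n => (Measure.pi fun _ : Fin n => μ).prod
        (Measure.pi fun _ : Fin (d - 1) => uniformPerm n))
      (f := fun n ω => dHSIC k (Y n ω) - populationDHSIC k ν) (fun n => ?_)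
      (hY.tendsto_integral_dHSIC_sub_sq hYm hk hC0 hC) (half_pos hμ)
    refine Integrable.of_bound
      ((((measurable_dHSIC hk).comp (hYm n)).sub_const _).pow_const 2).aestronglyMeasurable
      ((4 * C ^ d + |populationDHSIC k ν|) ^ 2) (.of_forall fun ω => ?_)
    rw [norm_pow]
    gcongr
    exact (norm_sub_le _ _).trans (add_le_add_left (abs_dHSIC_le hC0 hC _) _)
  have hobs := key (fun _ => measurable_fst) (asymptoticallyIID_sample (A := Fin (d - 1)) μ)
  have hperm := key (fun _ => measurable_from_prod_countable_left measurable_permAct)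
    (asymptoticallyIID_permAct μ)
  have hlim := hobs.add hperm
  rw [add_zero] at hlim
  refine tendsto_of_tendsto_of_tendsto_of_le_of_le tendsto_const_nhds hlim (fun _ => zero_le)
    fun n => ?_
  refine (measure_mono fun ω hω => ?_).trans (measure_union_le _ _)
  simp only [populationDHSIC_pi, sub_zero, Set.mem_union, Set.mem_ofPred_eq] at hω ⊢
  by_contra! hcon
  linarith [(abs_lt.1 hcon.1).1, (abs_lt.1 hcon.2).2]

/-- **Consistency of the dHSIC permutation test using a finite sample of permutation
vectors.**  Assume each kernel `k^j` is measurable, bounded and positive semidefinite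
and the product kernel is characteristic.  Let `μ` be a distribution that is not the
product of its `d` marginals, fix `α ∈ (0,1)` and `B ≥ 1/α − 1`, and let
`ψ_2, …, ψ_{B+1}` be i.i.d. permutation vectors (of `d−1` independent uniform
permutations) independent of the i.i.d. sample `D` of size `n` from `μ`.  Then the
conservative `p`-value `p̂ = (1 + #{i : dHSIĈ(ψ_i D) ≥ dHSIĈ(D)})/(B+1)` satisfies
`P(p̂ ≤ α) → 1` as `n → ∞`. -/
theorem consistency_finite_sample_permutations
    {d : ℕ} (hd : 2 ≤ d)
    (𝒳 : Fin d → Type*) [∀ j, MeasurableSpace (𝒳 j)]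
    (k : ∀ j, 𝒳 j → 𝒳 j → ℝ)
    (hkmeas : ∀ j, Measurable (fun p : 𝒳 j × 𝒳 j => k j p.1 p.2))
    (hkbdd : ∃ C : ℝ, ∀ j x y, |k j x y| ≤ C)
    (hpsd : ∀ j, IsPSDKernel (k j))
    (hchar : IsCharacteristic (fun x y : ∀ j, 𝒳 j => ∏ j, k j (x j) (y j)))
    (μ : Measure (∀ j, 𝒳 j)) [IsProbabilityMeasure μ]
    (halt : μ ≠ Measure.pi (fun j => μ.map (fun x => x j)))
    (α : ℝ) (hα : α ∈ Set.Ioo (0:ℝ) 1)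
    (B : ℕ) (hB : (1 : ℝ)/α - 1 ≤ B) :
    Tendsto (fun n : ℕ =>
        ((Measure.pi fun _ : Fin n => μ).prod
            (Measure.pi fun _ : Fin B => Measure.pi fun _ : Fin (d-1) => uniformPerm n))
          {ω | (1 + ((Finset.univ.filter
                (fun i : Fin B => dHSIC k (permAct (ω.2 i) ω.1) ≥ dHSIC k ω.1)).card : ℝ))
              / ((B : ℝ) + 1) ≤ α})
      atTop (nhds 1) := by
  obtain ⟨C, hC⟩ := hkbdd
  have hC' : ∀ j x y, |k j x y| ≤ |C| := fun j x y => (hC j x y).trans (le_abs_self C)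
  have hprob : ∀ j, IsProbabilityMeasure (μ.map fun x => x j) := fun j =>
    Measure.isProbabilityMeasure_map (measurable_pi_apply _).aemeasurable
  have hpos : 0 < populationDHSIC k μ := by
    have := hchar (Measure.pi fun j => μ.map fun x => x j) μ inferInstance inferInstance halt.symm
    rw [populationDHSIC]
    linarith
  have hone := tendsto_measure_dHSIC_le_dHSIC_permAct hkmeas (abs_nonneg C) hC' μ hpos
  have hmarg : ∀ (n : ℕ) (i : Fin B), ((Measure.pi fun _ : Fin n => μ).prod
      (Measure.pi fun _ : Fin B => Measure.pi fun _ : Fin (d-1) => uniformPerm n))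
        {ω | dHSIC k ω.1 ≤ dHSIC k (permAct (ω.2 i) ω.1)}
      = ((Measure.pi fun _ : Fin n => μ).prod (Measure.pi fun _ : Fin (d-1) => uniformPerm n))
        {ω | dHSIC k ω.1 ≤ dHSIC k (permAct ω.2 ω.1)} := fun n i => by
    have hmp := (MeasurePreserving.id (Measure.pi fun _ : Fin n => μ)).prod
      (measurePreserving_eval
        (fun _ : Fin B => Measure.pi fun _ : Fin (d-1) => uniformPerm n) i)
    have hs : MeasurableSet {ω : (Fin n → ∀ j, 𝒳 j) × (Fin (d-1) → Equiv.Perm (Fin n)) |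
        dHSIC k ω.1 ≤ dHSIC k (permAct ω.2 ω.1)} :=
      measurableSet_le ((measurable_dHSIC hkmeas).comp measurable_fst)
        ((measurable_dHSIC hkmeas).comp (measurable_from_prod_countable_left measurable_permAct))
    exact hmp.measure_preimage hs.nullMeasurableSet
  have hlim : Tendsto (fun n : ℕ => 1 - (B : ℝ≥0∞) * ((Measure.pi fun _ : Fin n => μ).prod
      (Measure.pi fun _ : Fin (d-1) => uniformPerm n))
        {ω | dHSIC k ω.1 ≤ dHSIC k (permAct ω.2 ω.1)}) atTop (nhds 1) := by
    have := ENNReal.Tendsto.sub (tendsto_const_nhds (x := (1 : ℝ≥0∞)))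
      (ENNReal.Tendsto.const_mul (a := (B : ℝ≥0∞)) hone (.inr (ENNReal.natCast_ne_top B)))
      (.inl ENNReal.one_ne_top)
    simpa using this
  refine tendsto_of_tendsto_of_tendsto_of_le_of_le hlim tendsto_const_nhds (fun n => ?_)
    fun n => prob_le_one
  set P := (Measure.pi fun _ : Fin n => μ).prod
    (Measure.pi fun _ : Fin B => Measure.pi fun _ : Fin (d-1) => uniformPerm n) with hP
  have hunion : P (⋃ i : Fin B, {ω | dHSIC k ω.1 ≤ dHSIC k (permAct (ω.2 i) ω.1)})
      ≤ (B : ℝ≥0∞) * ((Measure.pi fun _ : Fin n => μ).prod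
      (Measure.pi fun _ : Fin (d-1) => uniformPerm n))
        {ω | dHSIC k ω.1 ≤ dHSIC k (permAct ω.2 ω.1)} := by
    refine (measure_iUnion_fintype_le _ _).trans_eq ?_
    simp only [hP, hmarg, Finset.sum_const, Finset.card_univ, Fintype.card_fin, nsmul_eq_mul]
  refine (tsub_le_tsub_left hunion 1).trans ?_
  rw [tsub_le_iff_right, ← measure_univ (μ := P)]
  refine (measure_mono fun ω _ => ?_).trans (measure_union_le _ _)
  by_cases hω : ω ∈ ⋃ i : Fin B, {ω | dHSIC k ω.1 ≤ dHSIC k (permAct (ω.2 i) ω.1)}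
  · exact Or.inr hω
  refine Or.inl ?_
  have hempty : (Finset.univ.filter
      (fun i : Fin B => dHSIC k (permAct (ω.2 i) ω.1) ≥ dHSIC k ω.1)) = ∅ :=
    Finset.filter_eq_empty_iff.2 fun i _ hi => hω (Set.mem_iUnion.2 ⟨i, hi⟩)
  rw [Set.mem_ofPred_eq, hempty, Finset.card_empty, Nat.cast_zero, add_zero,
    div_le_iff₀ (by positivity)]
  rw [sub_le_iff_le_add, div_le_iff₀ hα.1] at hB
  linarith
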